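/- Let p be a prime number, n < p-1 a natural number, and (A,+) an abelian group of cardinality p^n. Let V be the set of non-associative words in variables X, Y in which Y occurs exactly once, at the end, and X occurs at least once. Then there exist integers e_w for w ∈ V, only finitely many of them nonzero, depending only on (A,+), such that for every brace (A,+,∘) with additive group (A,+) and all a, c ∈ A: [a]*[c] = Σ_{w∈V} e_w·w([a],[c]) in A/ann(p^2), where w([a],[c]) is the evaluation of w at X = [a], Y = [c] under the pre-Lie multiplication • constructed from the brace (A,+,∘). -/

import Mathlib

universe u

/-- A left brace: `(A,+)` abelian group, `(A,∘)` a group, with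
`a∘(b+c)+a = a∘b+a∘c`. -/
structure LeftBrace (A : Type u) [AddCommGroup A] where
  circ : A → A → A
  one : A
  inv : A → A
  circ_assoc : ∀ a b c : A, circ (circ a b) c = circ a (circ b c)
  one_circ : ∀ a : A, circ one a = a
  circ_one : ∀ a : A, circ a one = a
  inv_circ : ∀ a : A, circ (inv a) a = one
  circ_add : ∀ a b c : A, circ a (b + c) + a = circ a b + circ a c

/-- `a*b = a∘b - a - b`. -/
def LeftBrace.star {A : Type u} [AddCommGroup A] (B : LeftBrace A) (a b : A) : A :=
  B.circ a b - a - b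

/-- `ann(k) = {a : k•a = 0}`, as an additive subgroup. -/
def annSub (A : Type u) [AddCommGroup A] (k : ℕ) : AddSubgroup A where
  carrier := {a : A | k • a = 0}
  zero_mem' := by simp
  add_mem' := by
    intro a b ha hb
    have ha' : k • a = 0 := ha
    have hb' : k • b = 0 := hb
    show k • (a + b) = 0
    rw [smul_add, ha', hb', add_zero]
  neg_mem' := by
    intro a ha
    have ha' : k • a = 0 := ha
    show k • (-a) = 0
    rw [smul_neg, ha', neg_zero]

/-- The coset `[a]` of `a` in `A/ann(k)`. -/
def qmk {A : Type u} [AddCommGroup A] (k : ℕ) (a : A) : A ⧸ annSub A k :=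
  QuotientAddGroup.mk a

/-- Evaluation of a non-associative word under a binary operation `op`,
substituting `f i` for the variable `i`. -/
def wEval {α : Type*} {β : Type*} (op : β → β → β) (f : α → β) : FreeMagma α → β
  | FreeMagma.of a => f a
  | FreeMagma.mul x y => op (wEval op f x) (wEval op f y)

/-- The list of leaves (occurrences of variables, left to right) of a word. -/
def wLeaves {α : Type*} : FreeMagma α → List α
  | FreeMagma.of a => [a]
  | FreeMagma.mul x y => wLeaves x ++ wLeaves y

/-- The last (rightmost) variable of a word. -/
def wLast {α : Type*} : FreeMagma α → α
  | FreeMagma.of a => a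
  | FreeMagma.mul _ y => wLast y

/-- The number of occurrences of the variable `a` in a word. -/
def wCount {α : Type*} [DecidableEq α] (a : α) : FreeMagma α → ℕ
  | FreeMagma.of b => if b = a then 1 else 0
  | FreeMagma.mul x y => wCount a x + wCount a y

/-- The length (number of variable occurrences) of a word. -/
def wLen {α : Type*} : FreeMagma α → ℕ
  | FreeMagma.of _ => 1
  | FreeMagma.mul x y => wLen x + wLen y

/-- Left-normed product `a₁·(a₂·(⋯(aₘ·b)⋯))`. -/
def leftProd {Q : Type*} (mul : Q → Q → Q) : List Q → Q → Q
  | [], b => b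
  | a :: l, b => mul a (leftProd mul l b)

/-- `circPow B a k` is the product of `k` copies of `a` under `∘`. -/
def circPow {A : Type u} [AddCommGroup A] (B : LeftBrace A) (a : A) : ℕ → A
  | 0 => B.one
  | k + 1 => B.circ a (circPow B a k)

/-- `eSeq B a (i-1)` is `a_i`, where `a_1 = a` and `a_{i+1} = a * a_i`. -/
def eSeq {A : Type u} [AddCommGroup A] (B : LeftBrace A) (a : A) : ℕ → A
  | 0 => a
  | i + 1 => B.star a (eSeq B a i)

/-- `starIter B a b (i-1)` is `e_i`, where `e_1 = a*b` and `e_{i+1} = a*e_i`. -/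
def starIter {A : Type u} [AddCommGroup A] (B : LeftBrace A) (a b : A) : ℕ → A
  | 0 => B.star a b
  | i + 1 => B.star a (starIter B a b i)

/-- `iterOp op u v i` is `u ⊙ (u ⊙ (⋯ (u ⊙ v)))` with `i` applications of `u ⊙ ·`. -/
def iterOp {Q : Type*} (op : Q → Q → Q) (u v : Q) : ℕ → Q
  | 0 => v
  | i + 1 => op u (iterOp op u v i)

/-- `f(a) = Σ_{i=1}^{p−1} (C(p−1,i−1)/i)·e_i` where `e_1 = a`, `e_{i+1} = a*e_i`. -/
def fMap {A : Type u} [AddCommGroup A] (B : LeftBrace A) (p : ℕ) (a : A) : A :=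
  ∑ i ∈ Finset.Icc 1 (p - 1), (Nat.choose (p - 1) (i - 1) / i) • eSeq B a (i - 1)

/-- `braceChainAux B (i-1)` is `A^i`: `A^1 = A`, `A^{i+1}` the additive subgroup
generated by `{x*y : x ∈ A, y ∈ A^i}`. -/
def braceChainAux {A : Type u} [AddCommGroup A] (B : LeftBrace A) : ℕ → AddSubgroup A
  | 0 => ⊤
  | i + 1 => AddSubgroup.closure {z : A | ∃ x : A, ∃ y ∈ braceChainAux B i, z = B.star x y}

/-- `dSeq B a b i = (d_i, d_i')`: `d_0 = a`, `d_0' = b`, `d_{i+1} = d_i + d_i'`,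
`d_{i+1}' = d_i * d_i'`. -/
def dSeq {A : Type u} [AddCommGroup A] (B : LeftBrace A) (a b : A) : ℕ → A × A
  | 0 => (a, b)
  | i + 1 => ((dSeq B a b i).1 + (dSeq B a b i).2, B.star (dSeq B a b i).1 (dSeq B a b i).2)

open Polynomial in
theorem bz_comp_inv {k : Type*} [CommRing k] (T : k[X]) (hT : T.coeff 0 = 1) (N : ℕ) :
    ∃ Q : k[X], X ^ N ∣ Q.comp (X * T) - X := by
  induction N with
  | zero => exact ⟨X, by simp⟩
  | succ N ih =>
    obtain ⟨Q, r, hr⟩ := ih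
    refine ⟨Q - C (r.coeff 0) * X ^ N, ?_⟩
    have h1 : (Q - C (r.coeff 0) * X ^ N).comp (X * T) - X
        = X ^ N * (r - C (r.coeff 0) * T ^ N) := by
      simp only [sub_comp, mul_comp, C_comp, X_pow_comp]
      rw [mul_sub, ← hr]; ring
    rw [h1, pow_succ]
    apply mul_dvd_mul_left
    rw [X_dvd_iff]
    simp [coeff_zero_eq_eval_zero, eval_pow] at hT ⊢
    simp [hT]

open Polynomial in
theorem bz_inv_mod {k : Type*} [CommRing k] (T : k[X]) (hT : T.coeff 0 = 1) (N : ℕ) :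
    ∃ V : k[X], X ^ N ∣ V * T - 1 := by
  have h1 : X ∣ 1 - T := by rw [X_dvd_iff]; simp [hT]
  refine ⟨∑ i ∈ Finset.range N, (1 - T) ^ i, ?_⟩
  have h2 := geom_sum_mul (1 - T) N
  have h3 : (∑ i ∈ Finset.range N, (1 - T) ^ i) * T - 1 = -(1 - T) ^ N := by
    linear_combination -h2
  rw [h3]
  exact (dvd_neg).2 (pow_dvd_pow_of_dvd h1 N)

open Polynomial in
theorem bz_aeval_dvd {k E : Type*} [CommRing k] [Ring E] [Algebra k E] {L : E} {N : ℕ}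
    (hL : L ^ N = 0) {f : k[X]} (hf : X ^ N ∣ f) : aeval L f = 0 := by
  obtain ⟨r, rfl⟩ := hf
  simp [hL]

open Polynomial in
theorem bz_aeval_congr {k E : Type*} [CommRing k] [Ring E] [Algebra k E] {x y : E} {q : k}
    (h : q • x = q • y) (f : k[X]) : q • aeval x f = q • aeval y f := by
  have hp : ∀ i : ℕ, q • x ^ i = q • y ^ i := by
    intro i
    induction i with
    | zero => simp
    | succ i ih =>
      rw [pow_succ, ← smul_mul_assoc, ih, smul_mul_assoc, ← mul_smul_comm, h, mul_smul_comm,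
        pow_succ]
  induction f using Polynomial.induction_on' with
  | add f g hf hg => simp [hf, hg]
  | monomial i a => 
    simp only [aeval_monomial, ← Algebra.smul_def]
    rw [smul_comm, hp, smul_comm]

/-- The abstract data of the lambda-map of a brace. -/
structure BzCtx (p : ℕ) (k A : Type*) [CommRing k] [AddCommGroup A] [Module k A] where
  h : A → Module.End k A
  g : A → Module.End k A
  h_zero : h 0 = 1
  h_add : ∀ a b, h (a + h a b) = h a * h b
  hg : ∀ a, h a * g a = 1
  gh : ∀ a, g a * h a = 1
  nil : ∀ a, (h a - 1) ^ (p - 1) = 0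
  pnil : (p : k) ^ (p - 1) = 0
  unit : ∀ j : ℕ, 1 ≤ j → j < p → IsUnit (j : k)
  p2 : 2 ≤ p

namespace BzCtx

variable {p : ℕ} {k A : Type*} [CommRing k] [AddCommGroup A] [Module k A]

def L (c : BzCtx p k A) (a : A) : Module.End k A := c.h a - 1

theorem nilL (c : BzCtx p k A) (a : A) : c.L a ^ (p - 1) = 0 := c.nil a

def pw (c : BzCtx p k A) (a : A) : ℕ → A
  | 0 => 0
  | m + 1 => a + c.h a (pw c a m)

theorem h_pw (c : BzCtx p k A) (a : A) (m : ℕ) : c.h (c.pw a m) = c.h a ^ m := by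
  induction m with
  | zero => simp [pw, c.h_zero]
  | succ m ih => rw [pw, c.h_add, ih, pow_succ']

def Sop (p m : ℕ) (L : Module.End k A) : Module.End k A :=
  ∑ j ∈ Finset.range (p - 1), (Nat.choose m (j + 1) : k) • L ^ j

theorem Sop_succ {p m : ℕ} {L : Module.End k A} (hL : L ^ (p - 1) = 0) :
    Sop p (m + 1) L = 1 + (1 + L) * Sop p m L := by
  have h1 : Sop p (m + 1) L = (∑ j ∈ Finset.range (p - 1), (Nat.choose m j : k) • L ^ j)
      + Sop p m L := by
    unfold Sop
    rw [← Finset.sum_add_distrib]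
    refine Finset.sum_congr rfl fun j _ => ?_
    rw [Nat.choose_succ_succ, Nat.cast_add, add_smul]
  have h2 : (∑ j ∈ Finset.range (p - 1), (Nat.choose m j : k) • L ^ j) = 1 + L * Sop p m L := by
    have h3 := Finset.sum_range_succ (fun j => (Nat.choose m j : k) • L ^ j) (p - 1)
    rw [Finset.sum_range_succ'] at h3
    simp only [hL, smul_zero, add_zero] at h3
    rw [← h3, Sop, Finset.mul_sum, add_comm]
    simp [pow_succ']
  rw [h1, h2, add_mul, one_mul]; abel

theorem h_pow (c : BzCtx p k A) (a : A) (m : ℕ) :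
    c.h a ^ m = 1 + c.L a * Sop p m (c.L a) := by
  induction m with
  | zero => simp [Sop]
  | succ m ih =>
    rw [pow_succ', ih, Sop_succ (c.nilL a)]
    have : c.h a = 1 + c.L a := by simp [L]
    rw [this]; noncomm_ring

theorem pw_eq (c : BzCtx p k A) (a : A) (m : ℕ) : c.pw a m = Sop p m (c.L a) a := by
  induction m with
  | zero => simp [pw, Sop]
  | succ m ih =>
    rw [pw, ih, Sop_succ (c.nilL a)]
    have : c.h a = 1 + c.L a := by simp [L]
    rw [this]; simp

open Polynomial in
theorem exists_T (c : BzCtx p k A) (hp : p.Prime) (s : ℕ) : ∃ T : k[X], T.coeff 0 = 1 ∧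
    ∀ L : Module.End k A, Sop p (p ^ s) L = ((p ^ s : ℕ) : k) • aeval L T := by
  have h1 : ∀ j : ℕ, ∃ t : k, (j < p - 1 → (Nat.choose (p ^ s) (j + 1) : k) = (p ^ s : ℕ) * t)
      ∧ (j = 0 → t = 1) := by
    intro j
    by_cases hj : j = 0
    · subst hj; exact ⟨1, by simp, by simp⟩
    by_cases hj2 : j < p - 1
    · obtain ⟨u, hu⟩ := c.unit (j + 1) (by omega) (by omega)
      refine ⟨(Nat.choose (p ^ s - 1) j : k) * (↑u⁻¹ : k), fun _ => ?_, fun h => absurd h hj⟩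
      have h2 := Nat.add_one_mul_choose_eq (p ^ s - 1) j
      have h3 : p ^ s - 1 + 1 = p ^ s := Nat.sub_add_cancel (Nat.one_le_pow _ _ hp.pos)
      rw [h3] at h2
      have h4 : ((p ^ s : ℕ) : k) * (Nat.choose (p ^ s - 1) j : k)
          = (Nat.choose (p ^ s) (j + 1) : k) * u := by
        rw [hu, ← Nat.cast_mul, h2, Nat.cast_mul]
      rw [← mul_assoc, h4, mul_assoc, Units.mul_inv, mul_one]
    · exact ⟨0, fun h => absurd h hj2, fun h => absurd h hj⟩
  choose t ht ht0 using h1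
  refine ⟨∑ j ∈ Finset.range (p - 1), C (t j) * X ^ j, ?_, fun L => ?_⟩
  · have := c.p2
    simp [coeff_X_pow, ht0]
    omega
  · simp only [map_sum, map_mul, aeval_C, map_pow, aeval_X, Finset.smul_sum, Sop]
    refine Finset.sum_congr rfl fun j hj => ?_
    rw [ht j (Finset.mem_range.1 hj), mul_smul, Algebra.smul_def (t j)]

open Polynomial in
theorem pw_inj (c : BzCtx p k A) (hp : p.Prime) (s : ℕ) (a b : A)
    (hab : c.pw a (p ^ s) = c.pw b (p ^ s)) :
    ((p ^ s : ℕ) : k) • a = ((p ^ s : ℕ) : k) • b := by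
  obtain ⟨T, hT0, hT⟩ := c.exists_T hp s
  set q : k := ((p ^ s : ℕ) : k)
  have h1 : ∀ a, c.h (c.pw a (p ^ s)) = 1 + q • aeval (c.L a) (X * T) := by
    intro a
    rw [c.h_pw, c.h_pow, hT]; simp
  have h2 : q • aeval (c.L a) (X * T) = q • aeval (c.L b) (X * T) := by
    have := h1 a
    rw [hab, h1 b] at this
    exact (add_left_cancel this).symm
  obtain ⟨Q, hQ⟩ := bz_comp_inv T hT0 (p - 1)
  have h3 : ∀ a, aeval (aeval (c.L a) (X * T)) Q = c.L a := by
    intro a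
    have := bz_aeval_dvd (c.nilL a) hQ
    rw [map_sub, aeval_comp, sub_eq_zero, aeval_X] at this
    exact this
  have h4 : q • c.L a = q • c.L b := by
    rw [← h3 a, ← h3 b]; exact bz_aeval_congr h2 Q
  obtain ⟨V, hV⟩ := bz_inv_mod T hT0 (p - 1)
  have h5 : ∀ a, aeval (c.L a) V (aeval (c.L a) T a) = a := by
    intro a
    have := bz_aeval_dvd (c.nilL a) hV
    rw [map_sub, map_mul, map_one, sub_eq_zero] at this
    rw [← Module.End.mul_apply]
    erw [this]; rfl
  have h6 : ∀ a, c.pw a (p ^ s) = q • aeval (c.L a) T a := by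
    intro a
    rw [c.pw_eq, hT]; rfl
  have h7 := bz_aeval_congr h4 V
  calc q • a = q • aeval (c.L a) V (aeval (c.L a) T a) := by rw [h5]
    _ = (q • aeval (c.L a) V) (aeval (c.L a) T a) := rfl
    _ = aeval (c.L b) V (q • aeval (c.L a) T a) := by rw [h7, map_smul]; rfl
    _ = aeval (c.L b) V (q • aeval (c.L b) T b) := by rw [← h6, ← h6, hab]
    _ = q • b := by rw [map_smul, h5]

theorem pw_surj [Finite A] (c : BzCtx p k A) (hp : p.Prime) (s : ℕ) (y : A) :
    ∃ a, c.pw a (p ^ s) = ((p ^ s : ℕ) : k) • y := by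
  obtain ⟨T, hT0, hT⟩ := c.exists_T hp s
  set q : k := ((p ^ s : ℕ) : k) with hq
  let R := Set.range (fun y : A => q • y)
  have hch : ∀ r : R, ∃ a : A, q • a = r.1 := fun r => r.2
  choose φ hφ using hch
  let ψ : R → R := fun r => ⟨c.pw (φ r) (p ^ s), Polynomial.aeval (c.L (φ r)) T (φ r), by
    rw [c.pw_eq, hT]; rfl⟩
  have hinj : Function.Injective ψ := by
    intro r r' h
    have := c.pw_inj hp s (φ r) (φ r') (congrArg Subtype.val h)
    apply Subtype.ext
    rw [← hφ r, ← hφ r']; exact this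
  obtain ⟨r, hr⟩ := (Finite.injective_iff_surjective.1 hinj) ⟨q • y, y, rfl⟩
  exact ⟨φ r, congrArg Subtype.val hr⟩

theorem h_div [Finite A] (c : BzCtx p k A) (hp : p.Prime) (s : ℕ) (y : A) :
    ∃ e : Module.End k A, c.h ((p : k) ^ s • y) = 1 + (p : k) ^ s • e := by
  obtain ⟨T, hT0, hT⟩ := c.exists_T hp s
  obtain ⟨a, ha⟩ := c.pw_surj hp s y
  refine ⟨c.L a * Polynomial.aeval (c.L a) T, ?_⟩
  rw [← Nat.cast_pow, ← ha, c.h_pw, c.h_pow, hT]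
  simp

end BzCtx


/-- Iterated finite differences. -/
def bzD {V E : Type*} [AddCommGroup V] [AddCommGroup E] (φ : V → E) : List V → V → E
  | [], x => φ x
  | y :: l, x => bzD φ l (x + y) - bzD φ l x

theorem bzD_mid {V E : Type*} [AddCommGroup V] [AddCommGroup E] (φ : V → E) (pre suf : List V)
    (y d x : V) : bzD φ (pre ++ (y + d) :: suf) x
      = bzD φ (pre ++ y :: suf) x + bzD φ (pre ++ d :: suf) (x + y) := by
  induction pre generalizing x with
  | nil => simp [bzD, add_assoc]
  | cons z pre ih => 
    simp only [List.cons_append, bzD]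
    rw [ih, ih, add_right_comm x z y]; abel

theorem bzD_comp {V V' E : Type*} [AddCommGroup V] [AddCommGroup V'] [AddCommGroup E]
    (φ : V' → E) (σ : V →+ V') (l : List V) (x : V) :
    bzD (fun v => φ (σ v)) l x = bzD φ (l.map σ) (σ x) := by
  induction l generalizing x with
  | nil => simp [bzD]
  | cons z l ih => simp [bzD, ih]

theorem bzD_sum {V E k ι : Type*} [AddCommGroup V] [AddCommGroup E] [CommRing k] [Module k E]
    (s : Finset ι) (c : ι → k) (φ : ι → V → E) (l : List V) (x : V) :
    bzD (fun v => ∑ i ∈ s, c i • φ i v) l x = ∑ i ∈ s, c i • bzD (φ i) l x := by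
  induction l generalizing x with
  | nil => simp [bzD]
  | cons z l ih => simp [bzD, ih, smul_sub]

theorem bzD_smul {V E k : Type*} [AddCommGroup V] [AddCommGroup E] [CommRing k] [Module k E]
    (c : k) (φ : V → E) (l : List V) (x : V) :
    bzD (fun v => c • φ v) l x = c • bzD φ l x := by
  induction l generalizing x with
  | nil => simp [bzD]
  | cons z l ih => simp [bzD, ih, smul_sub]

def bzWt {A : Type*} (l : List (ℕ × A)) : ℕ := (l.map Prod.fst).sum

namespace BzCtx

variable {p : ℕ} {k A : Type*} [CommRing k] [AddCommGroup A] [Module k A]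

def vl (p : ℕ) (k : Type*) {A : Type*} [CommRing k] [AddCommGroup A] [Module k A]
    (l : List (ℕ × A)) : List A :=
  l.map (fun sy => (p : k) ^ sy.1 • sy.2)

theorem vl_map (f : Module.End k A) (l : List (ℕ × A)) :
    (vl p k l).map f = vl p k (l.map (fun sy => (sy.1, f sy.2))) := by
  simp [vl]

theorem wt_map (f : Module.End k A) (l : List (ℕ × A)) :
    bzWt (l.map (fun sy => (sy.1, f sy.2))) = bzWt l := by
  simp [bzWt, Function.comp_def]

theorem D_trans (c : BzCtx p k A) (l : List A) (x v : A) :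
    bzD c.h (l.map (c.h x)) (x + c.h x v) = c.h x * bzD c.h l v := by
  induction l generalizing v with
  | nil => simp [bzD, c.h_add]
  | cons y l ih =>
    simp only [List.map_cons, bzD]
    rw [mul_sub, ← ih, ← ih, map_add, add_assoc]

theorem D_trans' (c : BzCtx p k A) (l : List A) (x : A) :
    bzD c.h l x = c.h x * bzD c.h (l.map (c.g x)) 0 := by
  rw [← D_trans, map_zero, add_zero, List.map_map]
  congr 1
  have : (⇑(c.h x) ∘ ⇑(c.g x)) = id := by
    funext y
    have := congrArg (fun f => f y) (c.hg x)
    simpa using this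
  rw [this, List.map_id]

def Dv (p : ℕ) (W : ℕ) (f : Module.End k A) : Prop := ∃ e : Module.End k A, f = (p : k) ^ W • e

theorem Dv.add {W : ℕ} {f g : Module.End k A} (hf : Dv p W f) (hg : Dv p W g) :
    Dv p W (f + g) := by
  obtain ⟨e, rfl⟩ := hf
  obtain ⟨e', rfl⟩ := hg
  exact ⟨e + e', by rw [smul_add]⟩

theorem Dv.mul {W W' : ℕ} {f g : Module.End k A} (hf : Dv p W f) (hg : Dv p W' g) :
    Dv p (W + W') (f * g) := by
  obtain ⟨e, rfl⟩ := hf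
  obtain ⟨e', rfl⟩ := hg
  exact ⟨e * e', by rw [smul_mul_smul_comm, pow_add]⟩

theorem Dv.mul_left {W : ℕ} {g : Module.End k A} (f : Module.End k A) (hg : Dv p W g) :
    Dv p W (f * g) := by
  obtain ⟨e', rfl⟩ := hg
  exact ⟨f * e', by rw [mul_smul_comm]⟩

theorem D_div [Finite A] (c : BzCtx p k A) (hp : p.Prime) (m : ℕ) (l : List (ℕ × A))
    (hl : l.length = m) (x : A) : Dv p (bzWt l) (bzD c.h (vl p k l) x) := by
  -- translation reduces to base point 0
  have red : ∀ m : ℕ, (∀ l : List (ℕ × A), l.length = m → Dv p (bzWt l) (bzD c.h (vl p k l) 0)) →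
      ∀ l : List (ℕ × A), l.length = m → ∀ x, Dv p (bzWt l) (bzD c.h (vl p k l) x) := by
    intro m hm l hl x
    rw [D_trans', vl_map]
    apply Dv.mul_left
    rw [← wt_map (c.g x) l]
    exact hm _ (by simpa using hl)
  refine red m ?_ l hl x
  clear l hl x
  induction m with
  | zero =>
    intro l hl
    obtain rfl := List.length_eq_zero_iff.1 hl
    exact ⟨1, by simp [bzWt, vl, bzD, c.h_zero]⟩
  | succ m ih =>
    have ih' := red m ih
    intro l hl
    obtain _ | ⟨⟨t, z⟩, l⟩ := l
    · simp at hl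
    have hl' : l.length = m := by simpa using hl
    set Z : A := (p : k) ^ t • z with hZ
    obtain ⟨u, hu⟩ := c.h_div hp t z
    -- the inverse is also close to one
    have hgu : c.g Z = 1 + (p : k) ^ t • (-(c.g Z * u)) := by
      have h1 : c.g Z * c.h Z = c.g Z + (p : k) ^ t • (c.g Z * u) := by
        rw [hZ, hu, mul_add, mul_one, mul_smul_comm]
      rw [c.gh] at h1
      rw [h1, smul_neg]; abel
    set w : Module.End k A := -(c.g Z * u) with hw
    have key : ∀ (l pre : List (ℕ × A)), pre.length + l.length = m →
        Dv p (bzWt pre + bzWt l + t)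
          (bzD c.h (vl p k pre ++ vl p k (l.map (fun sy => (sy.1, c.g Z sy.2)))) 0
            - bzD c.h (vl p k pre ++ vl p k l) 0) := by
      intro l
      induction l with
      | nil => intro pre _; exact ⟨0, by simp [vl]⟩
      | cons sy l ihl =>
        obtain ⟨s, y⟩ := sy
        intro pre hpre
        set l' := l.map (fun sy => (sy.1, c.g Z sy.2)) with hl'
        have e1 : vl p k (((s, y) :: l).map (fun sy => (sy.1, c.g Z sy.2)))
            = ((p : k) ^ s • y + (p : k) ^ (s + t) • w y) :: vl p k l' := by
          simp only [vl, List.map_cons, hl']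
          congr 1
          conv_lhs => rw [hgu]
          simp [pow_add, smul_smul]
        have e2 : vl p k ((s, y) :: l) = ((p : k) ^ s • y) :: vl p k l := by simp [vl]
        rw [e1, e2, bzD_mid]
        have f1 := ihl (pre ++ [(s, y)]) (by simp at hpre ⊢; omega)
        have f2 := ih' (pre ++ (s + t, w y) :: l') (by simp [hl'] at hpre ⊢; omega)
          (0 + (p : k) ^ s • y)
        have e3 : vl p k (pre ++ [(s, y)]) = vl p k pre ++ [(p : k) ^ s • y] := by simp [vl]
        have e4 : vl p k (pre ++ (s + t, w y) :: l')
            = vl p k pre ++ ((p : k) ^ (s + t) • w y) :: vl p k l' := by simp [vl]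
        have e5 : bzWt (pre ++ [(s, y)]) + bzWt l + t = bzWt pre + bzWt ((s, y) :: l) + t := by
          simp [bzWt]; ring
        have e6 : bzWt (pre ++ (s + t, w y) :: l') = bzWt pre + bzWt ((s, y) :: l) + t := by
          have := wt_map (c.g Z) l
          rw [← hl'] at this
          simp [bzWt] at this ⊢
          rw [this]; ring
        rw [e3, e5] at f1
        rw [e4, e6] at f2
        have f3 := f1.add f2
        simp only [List.append_assoc, List.singleton_append] at f3
        convert f3 using 1
        abel
    have k1 := key l [] (by simpa using hl')
    have k2 : Dv p (t + bzWt l)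
        ((c.h Z - 1) * bzD c.h (vl p k (l.map (fun sy => (sy.1, c.g Z sy.2)))) 0) := by
      apply Dv.mul
      · exact ⟨u, by rw [hZ, hu]; simp⟩
      · rw [← wt_map (c.g Z) l]
        exact ih _ (by simpa using hl')
    have e1 : bzWt ((t, z) :: l) = t + bzWt l := by simp [bzWt]
    have e2 : bzD c.h (vl p k ((t, z) :: l)) 0
        = bzD c.h (vl p k l) Z - bzD c.h (vl p k l) 0 := by
      simp [vl, bzD, hZ]
    rw [e1, e2, D_trans', vl_map]
    have e3 : bzWt ([] : List (ℕ × A)) + bzWt l + t = t + bzWt l := by simp [bzWt]; ring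
    rw [e3] at k1
    convert k1.add k2 using 1
    simp [vl, sub_mul]

end BzCtx


def bzW1 {A : Type*} (l : List (ℕ × A)) : ℕ := (l.map (fun sy => sy.1 + 1)).sum

noncomputable def bzI {A : Type*} [AddCommGroup A] (l : List (ℕ × A)) : List (ℕ →₀ A) :=
  l.map (fun sy => Finsupp.single sy.1 sy.2)

noncomputable def bzSc {k A : Type*} [CommRing k] [AddCommGroup A] [Module k A] (c : k) :
    (ℕ →₀ A) →+ (ℕ →₀ A) :=
  Finsupp.liftAddHom (fun s => (Finsupp.singleAddHom s).comp
    (DistribSMul.toAddMonoidHom A (c ^ (s + 1))))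

theorem bzSc_single {k A : Type*} [CommRing k] [AddCommGroup A] [Module k A] (c : k) (s : ℕ)
    (y : A) : bzSc c (Finsupp.single s y) = Finsupp.single s (c ^ (s + 1) • y) := by
  simp [bzSc]

theorem bz_homog {k A E : Type*} [CommRing k] [AddCommGroup A] [Module k A] [AddCommGroup E]
    [Module k E] (P m : ℕ) (hu : IsUnit (m : k))
    (hξ : ∀ s : ℕ, 1 ≤ s → s < P → IsUnit ((m : k) ^ s - 1))
    (K : (ℕ →₀ A) → E) (hK : ∀ v, K (bzSc (m : k) v) = (m : k) • K v)
    (hv : ∀ l : List (ℕ × A), P ≤ bzW1 l → ∀ v, bzD K (bzI l) v = 0) (d : ℕ) :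
    ∀ l : List (ℕ × A), P ≤ bzW1 l + d → 2 ≤ bzW1 l → ∀ v, bzD K (bzI l) v = 0 := by
  induction d with
  | zero => intro l hl _; exact hv l hl
  | succ d ih =>
    intro l hl hl2
    by_cases hlt : P ≤ bzW1 l + d
    · exact ih l hlt hl2
    set W := bzW1 l with hW
    have const : ∀ l' : List (ℕ × A), bzW1 l' = W → ∀ v, bzD K (bzI l') v = bzD K (bzI l') 0 := by
      intro l' hl' v
      have tr : ∀ (s : ℕ) (y : A) (v : ℕ →₀ A),
          bzD K (bzI l') (v + Finsupp.single s y) = bzD K (bzI l') v := by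
        intro s y v
        have := ih ((s, y) :: l') (by simp [bzW1] at hl' ⊢; omega) (by simp [bzW1] at hl' ⊢; omega) v
        simpa [bzI, bzD, sub_eq_zero] using this
      induction v using Finsupp.induction with
      | zero => rfl
      | single_add s y f _ _ hf => rw [add_comm, tr, hf]
    have lin : ∀ (pre suf : List (ℕ × A)) (s : ℕ) (y : A), bzW1 (pre ++ (s, y) :: suf) = W →
        bzD K (bzI (pre ++ (s, (m : k) ^ (s + 1) • y) :: suf)) 0
          = (m : k) ^ (s + 1) • bzD K (bzI (pre ++ (s, y) :: suf)) 0 := by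
      intro pre suf s y hw
      have hw' : ∀ y', bzW1 (pre ++ (s, y') :: suf) = W := by
        intro y'; rw [← hw]; simp [bzW1]
      have hI : ∀ y', bzI (pre ++ (s, y') :: suf) = bzI pre ++ Finsupp.single s y' :: bzI suf := by
        intro y'; simp [bzI]
      let f : A →+ E := AddMonoidHom.mk' (fun y' => bzD K (bzI (pre ++ (s, y') :: suf)) 0) (by
        intro a b
        have h1 := const _ (hw' b) (0 + Finsupp.single s a)
        rw [hI] at h1
        rw [hI, hI, hI, Finsupp.single_add, bzD_mid, h1])
      have h2 := map_nsmul f (m ^ (s + 1)) y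
      rw [← Nat.cast_smul_eq_nsmul k, ← Nat.cast_smul_eq_nsmul k, Nat.cast_pow] at h2
      exact h2
    have multi : ∀ (l pre : List (ℕ × A)), bzW1 (pre ++ l) = W →
        bzD K (bzI (pre ++ l.map (fun sy => (sy.1, (m : k) ^ (sy.1 + 1) • sy.2)))) 0
          = (m : k) ^ (bzW1 l) • bzD K (bzI (pre ++ l)) 0 := by
      intro l
      induction l with
      | nil => intro pre _; simp [bzW1]
      | cons sy l ihl =>
        obtain ⟨s, y⟩ := sy
        intro pre hw
        have h1 := lin pre l s y hw
        have h2 := ihl (pre ++ [(s, (m : k) ^ (s + 1) • y)]) (by rw [← hw]; simp [bzW1])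
        simp only [List.append_assoc, List.singleton_append] at h2
        simp only [List.map_cons]
        rw [h2, h1, smul_smul, ← pow_add]
        congr 2
        simp [bzW1]; ring
    have hom : bzD K (bzI (l.map (fun sy => (sy.1, (m : k) ^ (sy.1 + 1) • sy.2)))) 0
        = (m : k) • bzD K (bzI l) 0 := by
      have h1 := bzD_comp K (bzSc (m : k)) (bzI l) 0
      simp only [hK] at h1
      rw [bzD_smul, map_zero] at h1
      rw [h1]
      congr 1
      simp [bzI, bzSc_single]
    intro v
    rw [const l rfl]
    have h3 := multi l [] (by simp [hW])
    simp only [List.nil_append] at h3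
    rw [hom, ← hW] at h3
    obtain ⟨W', hW'⟩ : ∃ W', W = W' + 1 := ⟨W - 1, by omega⟩
    have h4 := hu.mul (hξ W' (by omega) (by omega))
    rw [← h4.smul_eq_zero, mul_sub, mul_one, ← pow_succ', ← hW', sub_smul, ← h3, sub_self]

namespace BzCtx

variable {p : ℕ} {k A : Type*} [CommRing k] [AddCommGroup A] [Module k A]

noncomputable def sig (p : ℕ) (k : Type*) {A : Type*} [CommRing k] [AddCommGroup A] [Module k A] :
    (ℕ →₀ A) →+ A :=
  Finsupp.liftAddHom (fun s => DistribSMul.toAddMonoidHom A ((p : k) ^ (s + 1)))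

theorem sig_single (s : ℕ) (y : A) :
    sig p k (Finsupp.single s y) = (p : k) ^ (s + 1) • y := by
  simp [sig]

theorem Sc_mul (a b : k) (v : ℕ →₀ A) : bzSc a (bzSc b v) = bzSc (a * b) v := by
  induction v using Finsupp.induction_linear with
  | zero => simp
  | add f g hf hg => simp only [map_add, hf, hg]
  | single s y => simp [bzSc_single, smul_smul, mul_pow]

theorem Sc_one (v : ℕ →₀ A) : bzSc (1 : k) v = v := by
  induction v using Finsupp.induction_linear with
  | zero => simp
  | add f g hf hg => simp only [map_add, hf, hg]
  | single s y => simp [bzSc_single]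

noncomputable def KK (c : BzCtx p k A) (m : ℕ) (v : ℕ →₀ A) : Module.End k A :=
  ∑ i ∈ Finset.range (p - 1), (m : k) ^ (p - 1 - i) • c.h (sig p k (bzSc ((m : k) ^ i) v))

theorem KK_hom (c : BzCtx p k A) (m : ℕ) (hm : (m : k) ^ (p - 1) = 1) (v : ℕ →₀ A) :
    c.KK m (bzSc (m : k) v) = (m : k) • c.KK m v := by
  let f : ℕ → Module.End k A :=
    fun i => (m : k) ^ (p - 1 - i) • c.h (sig p k (bzSc ((m : k) ^ i) v))
  have h1 : ∑ i ∈ Finset.range (p - 1), f (i + 1) = ∑ i ∈ Finset.range (p - 1), f i := by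
    have h2 := Finset.sum_range_succ f (p - 1)
    rw [Finset.sum_range_succ'] at h2
    have h3 : f (p - 1) = f 0 := by simp [f, hm]
    rw [h3] at h2
    exact add_right_cancel h2
  unfold KK
  change _ = (m : k) • ∑ i ∈ Finset.range (p - 1), f i
  rw [← h1, Finset.smul_sum]
  refine Finset.sum_congr rfl fun i hi => ?_
  have hi' := Finset.mem_range.1 hi
  simp only [f]
  rw [smul_smul, ← pow_succ', Sc_mul, ← pow_succ]
  congr 2
  omega

theorem KK_vanish [Finite A] (c : BzCtx p k A) (hp : p.Prime) (m : ℕ)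
    (hm : (m : k) ^ (p - 1) = 1)
    (hξ : ∀ s : ℕ, 1 ≤ s → s < p - 1 → IsUnit ((m : k) ^ s - 1))
    (l : List (ℕ × A)) (hl : 2 ≤ bzW1 l) (v : ℕ →₀ A) : bzD (c.KK m) (bzI l) v = 0 := by
  have hu : IsUnit (m : k) := by
    have := c.p2
    exact IsUnit.of_pow_eq_one hm (by omega)
  refine bz_homog (p - 1) m hu hξ (c.KK m) (c.KK_hom m hm) ?_ (p - 1) l (by omega) hl v
  clear l hl v
  intro l hl v
  have h1 : ∀ i : ℕ, bzD (fun v => c.h (sig p k (bzSc ((m : k) ^ i) v))) (bzI l) v = 0 := by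
    intro i
    have h2 := bzD_comp c.h ((sig p k (A := A)).comp (bzSc ((m : k) ^ i))) (bzI l) v
    let l' : List (ℕ × A) := l.map (fun sy => (sy.1 + 1, ((m : k) ^ i) ^ (sy.1 + 1) • sy.2))
    have h3 : (bzI l).map ((sig p k (A := A)).comp (bzSc ((m : k) ^ i))) = vl p k l' := by
      simp [bzI, vl, l', bzSc_single, sig_single, Function.comp_def]
    have h4 : bzWt l' = bzW1 l := by simp [bzWt, bzW1, l', Function.comp_def]
    rw [h3] at h2
    obtain ⟨e, he⟩ := c.D_div hp _ l' rfl (((sig p k (A := A)).comp (bzSc ((m : k) ^ i))) v)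
    rw [he] at h2
    have h5 : (p : k) ^ (bzWt l') = 0 := pow_eq_zero_of_le (h4 ▸ hl) c.pnil
    rw [h5, zero_smul] at h2
    exact h2
  unfold KK
  rw [bzD_sum]
  simp [h1]

noncomputable def kap (c : BzCtx p k A) (m : ℕ) (x : A) : Module.End k A :=
  ∑ i ∈ Finset.range (p - 1), (m : k) ^ (p - 1 - i) • (c.h ((p : k) • (m : k) ^ i • x) - 1)

theorem kap_eq (c : BzCtx p k A) (m : ℕ) (x : A) :
    c.kap m x = c.KK m (Finsupp.single 0 x) - c.KK m 0 := by
  simp only [kap, KK, ← Finset.sum_sub_distrib, ← smul_sub, map_zero, c.h_zero]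
  simp [bzSc_single, sig_single]

theorem kap_add [Finite A] (c : BzCtx p k A) (hp : p.Prime) (m : ℕ)
    (hm : (m : k) ^ (p - 1) = 1)
    (hξ : ∀ s : ℕ, 1 ≤ s → s < p - 1 → IsUnit ((m : k) ^ s - 1)) (x y : A) :
    c.kap m (x + y) = c.kap m x + c.kap m y := by
  have := c.KK_vanish hp m hm hξ [(0, y), (0, x)] (by simp [bzW1]) 0
  simp only [bzI, bzD, List.map_cons, List.map_nil, zero_add] at this
  simp only [kap_eq]
  rw [add_comm x y, Finsupp.single_add]
  rw [sub_sub, sub_eq_zero] at this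
  rw [this]; abel

theorem KK_sum [Finite A] (c : BzCtx p k A) (hp : p.Prime) (m : ℕ)
    (hm : (m : k) ^ (p - 1) = 1)
    (hξ : ∀ s : ℕ, 1 ≤ s → s < p - 1 → IsUnit ((m : k) ^ s - 1)) (x : ℕ → A) (J : ℕ) :
    c.KK m (∑ s ∈ Finset.range (J + 1), Finsupp.single s (x s)) - c.KK m 0 = c.kap m (x 0) := by
  induction J with
  | zero => simp [kap_eq]
  | succ J ih =>
    rw [← ih, Finset.sum_range_succ]
    have := c.KK_vanish hp m hm hξ [(J + 1, x (J + 1))] (by simp [bzW1])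
      (∑ s ∈ Finset.range (J + 1), Finsupp.single s (x s))
    simp only [bzI, bzD, List.map_cons, List.map_nil] at this
    rw [sub_eq_zero.1 this]

end BzCtx


namespace BzCtx

variable {p : ℕ} {k A : Type*} [CommRing k] [AddCommGroup A] [Module k A]

open Polynomial in
theorem exists_cpoly (unit : ∀ j : ℕ, 1 ≤ j → j < p → IsUnit (j : k)) (j : ℕ) :
    ∃ c : k[X], (j < p - 1 → c.natDegree ≤ j ∧
      ∀ M : ℕ, (Nat.choose M (j + 1) : k) = M * c.eval (M : k)) ∧ (j = 0 → c = 1) := by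
  induction j with
  | zero => exact ⟨1, fun _ => ⟨by simp, by simp⟩, fun _ => rfl⟩
  | succ j ih =>
    obtain ⟨c, hc, -⟩ := ih
    by_cases hj : j + 1 < p - 1
    · obtain ⟨hd, hM⟩ := hc (by omega)
      obtain ⟨u, hu⟩ := unit (j + 2) (by omega) (by omega)
      refine ⟨C (↑u⁻¹ : k) * (c * (X - C ((j + 1 : ℕ) : k))), fun _ => ⟨?_, fun M => ?_⟩,
        fun h => by omega⟩
      · refine (natDegree_C_mul_le _ _).trans (natDegree_mul_le.trans ?_)
        exact add_le_add hd (natDegree_X_sub_C_le _)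
      · have h1 := Nat.choose_succ_right_eq M (j + 1)
        have h2 : (Nat.choose M (j + 2) : k) * u
            = (Nat.choose M (j + 1) : k) * ((M : k) - ((j + 1 : ℕ) : k)) := by
          rw [hu]
          by_cases hle : j + 1 ≤ M
          · rw [← Nat.cast_sub hle, ← Nat.cast_mul, ← Nat.cast_mul, ← h1]
          · rw [Nat.choose_eq_zero_of_lt (by omega : M < j + 2),
              Nat.choose_eq_zero_of_lt (by omega : M < j + 1)]
            simp
        rw [hM] at h2
        have h3 : (Nat.choose M (j + 2) : k) = (Nat.choose M (j + 2) : k) * u * (↑u⁻¹ : k) := by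
          rw [mul_assoc, Units.mul_inv, mul_one]
        change (Nat.choose M (j + 2) : k) = _
        rw [h3, h2]
        simp only [eval_mul, eval_C, eval_sub, eval_X]
        ring
    · exact ⟨0, fun h => absurd h hj, fun h => by omega⟩

open Polynomial in
theorem exists_V (A : Type*) [AddCommGroup A] [Module k A] [Finite A]
    (unit : ∀ j : ℕ, 1 ≤ j → j < p → IsUnit (j : k)) (hp : p.Prime) (m : ℕ)
    (hm : (m : k) ^ (p - 1) = 1)
    (hξ : ∀ s : ℕ, 1 ≤ s → s < p - 1 → IsUnit ((m : k) ^ s - 1)) :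
    ∃ V : k[X], V.coeff 0 = 1 ∧ ∀ (c : BzCtx p k A) (b : A),
      c.kap m (aeval (c.L b) V b)
        = (p : k) • ((p - 1 : ℕ) : k) • (c.L b * aeval (c.L b) V) := by
  choose cf hcf hcf0 using fun j => exists_cpoly (p := p) unit j
  have p2 := hp.two_le
  let Vs : ℕ → k[X] := fun s => ∑ j ∈ Finset.range (p - 1), C ((cf j).coeff s) * X ^ j
  refine ⟨Vs 0, ?_, fun c b => ?_⟩
  · simp [Vs, coeff_X_pow, hcf0]
    omega
  let Xs : ℕ → Module.End k A := fun s => aeval (c.L b) (Vs s)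
  have hS : ∀ M : ℕ, Sop p M (c.L b)
      = ∑ s ∈ Finset.range (p - 1), (M : k) ^ (s + 1) • Xs s := by
    intro M
    simp only [Sop, Xs, Vs, map_sum, Finset.smul_sum]
    rw [Finset.sum_comm]
    refine Finset.sum_congr rfl fun j hj => ?_
    have hj' := Finset.mem_range.1 hj
    obtain ⟨hd, hM⟩ := hcf j hj'
    rw [hM, eval_eq_sum_range' (lt_of_le_of_lt hd hj'), Finset.mul_sum, Finset.sum_smul]
    refine Finset.sum_congr rfl fun s _ => ?_
    simp only [map_mul, aeval_C, map_pow, aeval_X]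
    rw [← Algebra.smul_def, smul_smul]
    congr 1; ring
  let v : ℕ →₀ A := ∑ s ∈ Finset.range (p - 2 + 1), Finsupp.single s (Xs s b)
  have hp1 : p - 2 + 1 = p - 1 := by omega
  have h1 := c.KK_sum hp m hm hξ (fun s => Xs s b) (p - 2)
  have h2 : ∀ i : ℕ, sig p k (bzSc ((m : k) ^ i) v) = c.pw b (p * m ^ i) := by
    intro i
    rw [c.pw_eq, hS]
    simp only [v, hp1, map_sum, bzSc_single, sig_single, LinearMap.sum_apply]
    refine Finset.sum_congr rfl fun s _ => ?_
    rw [LinearMap.smul_apply, smul_smul, Nat.cast_mul, Nat.cast_pow, mul_pow]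
  have h3 : c.KK m v - c.KK m 0 = ∑ i ∈ Finset.range (p - 1), (m : k) ^ (p - 1 - i) •
      ∑ s ∈ Finset.range (p - 1), ((p * m ^ i : ℕ) : k) ^ (s + 1) • (c.L b * Xs s) := by
    simp only [KK, ← Finset.sum_sub_distrib, ← smul_sub, map_zero, c.h_zero]
    refine Finset.sum_congr rfl fun i _ => ?_
    rw [h2, c.h_pw, c.h_pow, hS, add_sub_cancel_left, Finset.mul_sum]
    simp only [mul_smul_comm]
  have h4 : ∀ s ∈ Finset.range (p - 1), s ≠ 0 →
      ∑ i ∈ Finset.range (p - 1), ((m : k) ^ s) ^ i = 0 := by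
    intro s hs hs0
    have hs' := Finset.mem_range.1 hs
    have h5 := geom_sum_mul ((m : k) ^ s) (p - 1)
    rw [← pow_mul, mul_comm s, pow_mul, hm, one_pow, sub_self] at h5
    exact (hξ s (by omega) hs').mul_left_eq_zero.1 h5
  have h6 : c.KK m v - c.KK m 0 = ∑ s ∈ Finset.range (p - 1),
      ((p : k) ^ (s + 1) * ∑ i ∈ Finset.range (p - 1), ((m : k) ^ s) ^ i) • (c.L b * Xs s) := by
    rw [h3]
    simp only [Finset.smul_sum]
    rw [Finset.sum_comm]
    refine Finset.sum_congr rfl fun s _ => ?_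
    rw [Finset.mul_sum, Finset.sum_smul]
    refine Finset.sum_congr rfl fun i hi => ?_
    have hi' := Finset.mem_range.1 hi
    rw [smul_smul]
    congr 1
    have h7 : (m : k) ^ (p - 1 - i) * (m : k) ^ i = 1 := by
      rw [← pow_add, Nat.sub_add_cancel (by omega), hm]
    push_cast
    rw [mul_pow, pow_succ ((m : k) ^ i), ← pow_mul, ← pow_mul, mul_comm i s]
    linear_combination ((p : k) ^ (s + 1) * (m : k) ^ (s * i)) * h7
  rw [Finset.sum_eq_single_of_mem 0 (Finset.mem_range.2 (by omega)) (fun s hs hs0 => by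
    rw [h4 s hs hs0, mul_zero, zero_smul])] at h6
  rw [show c.kap m (aeval (c.L b) (Vs 0) b) = c.KK m v - c.KK m 0 from h1.symm, h6, smul_smul]
  simp [Xs]

open Polynomial in
theorem exists_ve (A : Type*) [AddCommGroup A] [Module k A] [Finite A]
    (unit : ∀ j : ℕ, 1 ≤ j → j < p → IsUnit (j : k)) (hp : p.Prime) (m : ℕ)
    (hm : (m : k) ^ (p - 1) = 1)
    (hξ : ∀ s : ℕ, 1 ≤ s → s < p - 1 → IsUnit ((m : k) ^ s - 1)) :
    ∃ v e : k[X], e.coeff 0 = 0 ∧ ∀ (c : BzCtx p k A) (b : A), ∃ (w : A) (D : Module.End k A),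
      c.kap m w = (p : k) • D ∧ aeval D v w = b ∧ aeval D e = c.L b := by
  obtain ⟨V, hV0, hV⟩ := exists_V A unit hp m hm hξ
  have p2 := hp.two_le
  obtain ⟨Q, hQ⟩ := bz_comp_inv V hV0 (p - 1)
  obtain ⟨Vi, hVi⟩ := bz_inv_mod V hV0 (p - 1)
  obtain ⟨u, hu⟩ := unit (p - 1) (by omega) (by omega)
  let e : k[X] := Q.comp (C (↑u⁻¹ : k) * X)
  refine ⟨Vi.comp e, e, ?_, fun c b => ⟨aeval (c.L b) V b,
    ((p - 1 : ℕ) : k) • (c.L b * aeval (c.L b) V), hV c b, ?_⟩⟩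
  · have h1 : X ∣ Q.comp (X * V) - X := (dvd_pow_self X (by omega)).trans hQ
    rw [X_dvd_iff, coeff_zero_eq_eval_zero] at h1
    rw [coeff_zero_eq_eval_zero]
    simpa [e, eval_comp] using h1
  have he : aeval (((p - 1 : ℕ) : k) • (c.L b * aeval (c.L b) V)) e = c.L b := by
    have h2 := bz_aeval_dvd (c.nilL b) hQ
    rw [map_sub, aeval_comp, sub_eq_zero, aeval_X] at h2
    simp only [e, aeval_comp]
    rw [map_mul, aeval_C, aeval_X, ← Algebra.smul_def, smul_smul, ← hu, Units.inv_mul, one_smul]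
    rw [map_mul, aeval_X] at h2
    exact h2
  refine ⟨?_, he⟩
  rw [aeval_comp, he]
  have h3 := bz_aeval_dvd (c.nilL b) hVi
  rw [map_sub, map_mul, map_one, sub_eq_zero] at h3
  rw [← Module.End.mul_apply]
  erw [h3]; rfl

end BzCtx


theorem bz_nilp {k A : Type*} [CommRing k] [AddCommGroup A] [Module k A] {p n : ℕ}
    (hp : p.Prime) (hcard : Nat.card A = p ^ n) (L : Module.End k A) (hL : IsNilpotent L) :
    L ^ n = 0 := by
  have hfin : Finite A := Nat.finite_of_card_ne_zero (by rw [hcard]; exact pow_ne_zero _ hp.ne_zero)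
  have key : ∀ i : ℕ, L ^ i ≠ 0 → p ^ i * Nat.card (LinearMap.range (L ^ i)) ≤ p ^ n := by
    intro i
    induction i with
    | zero =>
      intro _
      rw [pow_zero, one_mul, ← hcard]
      exact Nat.card_le_card_of_injective _ Subtype.val_injective
    | succ i ih =>
      intro hne
      have hne' : L ^ i ≠ 0 := fun h => hne (by rw [pow_succ, h, zero_mul])
      have h1 := ih hne'
      have hle : LinearMap.range (L ^ (i + 1)) ≤ LinearMap.range (L ^ i) := by
        rintro _ ⟨x, rfl⟩
        exact ⟨L x, by rw [pow_succ]; rfl⟩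
      have hneq : LinearMap.range (L ^ (i + 1)) ≠ LinearMap.range (L ^ i) := by
        intro heq
        obtain ⟨N, hN⟩ := hL
        have h2 : ∀ j, LinearMap.range (L ^ (i + j)) = LinearMap.range (L ^ i) := by
          intro j
          induction j with
          | zero => rfl
          | succ j ihj =>
            rw [← heq, ← add_assoc, pow_succ', pow_succ' L i, Module.End.mul_eq_comp,
              Module.End.mul_eq_comp, LinearMap.range_comp, LinearMap.range_comp, ihj]
        have h3 := h2 N
        rw [pow_add, hN, mul_zero, LinearMap.range_zero] at h3
        exact hne' (LinearMap.range_eq_bot.1 h3.symm)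
      have hdvd : Nat.card (LinearMap.range (L ^ (i + 1))) ∣ Nat.card (LinearMap.range (L ^ i)) :=
        AddSubgroup.card_dvd_of_le (H := (LinearMap.range (L ^ (i + 1))).toAddSubgroup)
          (K := (LinearMap.range (L ^ i)).toAddSubgroup) hle
      have hdvd2 : Nat.card (LinearMap.range (L ^ i)) ∣ p ^ n := by
        rw [← hcard]
        exact AddSubgroup.card_addSubgroup_dvd_card (LinearMap.range (L ^ i)).toAddSubgroup
      obtain ⟨t, ht⟩ := hdvd
      have ht1 : t ≠ 1 := by
        rintro rfl
        rw [mul_one] at ht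
        apply hneq
        apply SetLike.coe_injective
        refine Set.eq_of_subset_of_ncard_le hle ?_ (Set.toFinite _)
        exact ht.le
      have htp : p ≤ t := by
        obtain ⟨a, _, ha⟩ := (Nat.dvd_prime_pow hp).1
          ((Dvd.intro_left _ ht.symm).trans hdvd2 : t ∣ p ^ n)
        have : a ≠ 0 := by rintro rfl; exact ht1 (by simpa using ha)
        rw [ha]
        exact Nat.le_self_pow this p
      calc p ^ (i + 1) * Nat.card (LinearMap.range (L ^ (i + 1)))
          = p ^ i * (Nat.card (LinearMap.range (L ^ (i + 1))) * p) := by ring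
        _ ≤ p ^ i * (Nat.card (LinearMap.range (L ^ (i + 1))) * t) := by gcongr
        _ ≤ p ^ n := by rw [← ht]; exact h1
  by_contra hne
  have h1 := key n hne
  have h2 : Nat.card (LinearMap.range (L ^ n)) ≤ 1 := by
    have := Nat.pos_of_ne_zero (pow_ne_zero n hp.ne_zero)
    by_contra hlt
    push Not at hlt
    nlinarith
  have h3 : Subsingleton (LinearMap.range (L ^ n)) := (Finite.card_le_one_iff_subsingleton).1 h2
  apply hne
  rw [← LinearMap.range_eq_bot]
  exact (Submodule.subsingleton_iff_eq_bot).1 h3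

theorem bz_nilp2 {k A : Type*} [CommRing k] [AddCommGroup A] [Module k A] {p n : ℕ}
    (hp : p.Prime) (hpk : (p : k) ^ n = 0)
    (f : Module.End k A) (hf : f ^ (p ^ n) = 1) : IsNilpotent (f - 1) := by
  obtain ⟨r, hr⟩ := (Commute.one_right (f - 1)).exists_add_pow_prime_pow_eq hp n
  rw [sub_add_cancel, hf, one_pow] at hr
  have hpE : (p : Module.End k A) ^ n = 0 := by
    rw [← map_natCast (algebraMap k (Module.End k A)) p, ← map_pow, hpk, map_zero]
  have h1 : (f - 1) ^ p ^ n = (p : Module.End k A) * (-((f - 1) * 1 * r)) := by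
    rw [mul_neg]
    have h2 : (f - 1) ^ p ^ n + (p : Module.End k A) * ((f - 1) * 1 * r) = 0 := by
      have h3 : (1 : Module.End k A) + 0
        = 1 + ((f - 1) ^ p ^ n + (p : Module.End k A) * ((f - 1) * 1 * r)) := by
        rw [add_zero]; conv_lhs => rw [hr]
        simp only [mul_assoc]; abel
      exact (add_left_cancel h3).symm
    exact eq_neg_of_add_eq_zero_left h2
  refine ⟨p ^ n * n, ?_⟩
  rw [pow_mul, h1, (Nat.cast_commute p _).mul_pow, hpE, zero_mul]

section brace
variable {A : Type u} [AddCommGroup A]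

theorem LeftBrace.circ_zero (B : LeftBrace A) (a : A) : B.circ a 0 = a := by
  have := B.circ_add a 0 0
  rw [add_zero] at this
  exact (add_left_cancel this).symm

theorem LeftBrace.one_eq (B : LeftBrace A) : B.one = 0 := by
  rw [← B.circ_zero B.one, B.one_circ]

def LeftBrace.lamA (B : LeftBrace A) (a : A) : A →+ A :=
  AddMonoidHom.mk' (fun b => B.circ a b - a) (by
    intro b c
    have := B.circ_add a b c
    rw [← sub_eq_zero] at this ⊢
    rw [← this]; abel)

theorem LeftBrace.lam_pow (B : LeftBrace A) {k : Type*} [CommRing k] [Module k A]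
    (h : A → Module.End k A) (h1 : h B.one = 1) (hm : ∀ a b, h (B.circ a b) = h a * h b) (a : A) :
    h a ^ Nat.card A = 1 ∧ h a * h (B.inv a) = 1 ∧ h (B.inv a) * h a = 1 := by
  let _ : Mul A := ⟨B.circ⟩
  let _ : One A := ⟨B.one⟩
  let _ : Inv A := ⟨B.inv⟩
  let _ : Group A := Group.ofLeftAxioms B.circ_assoc B.one_circ B.inv_circ
  let φ : A →* Module.End k A := { toFun := h, map_one' := h1, map_mul' := hm }
  refine ⟨?_, ?_, ?_⟩
  · change φ a ^ Nat.card A = 1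
    rw [← map_pow, pow_card_eq_one', map_one]
  · change φ a * φ a⁻¹ = 1
    rw [← map_mul, mul_inv_cancel, map_one]
  · change φ a⁻¹ * φ a = 1
    rw [← map_mul, inv_mul_cancel, map_one]

theorem bz_unit {p : ℕ} (n : ℕ) (hp : p.Prime) (j : ℕ) (h : ¬ p ∣ j) :
    IsUnit (j : ZMod (p ^ n)) := by
  rw [ZMod.isUnit_iff_coprime]
  exact Nat.Coprime.pow_right _ ((Nat.Prime.coprime_iff_not_dvd hp).2 h).symm

theorem LeftBrace.exists_ctx (B : LeftBrace A) {p n : ℕ} (hp : p.Prime) (hn : n < p - 1)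
    [Module (ZMod (p ^ n)) A] (hcard : Nat.card A = p ^ n) :
    ∃ c : BzCtx p (ZMod (p ^ n)) A, ∀ a b, c.h a b = B.circ a b - a := by
  let h : A → Module.End (ZMod (p ^ n)) A := fun a => (B.lamA a).toZModLinearMap (p ^ n)
  have hab : ∀ a b, h a b = B.circ a b - a := fun a b => rfl
  have h1 : h B.one = 1 := by
    ext b
    rw [hab, B.one_circ, B.one_eq]; simp
  have hm : ∀ a b, h (B.circ a b) = h a * h b := by
    intro a b
    ext x
    rw [Module.End.mul_apply, hab b x, map_sub, hab, hab, hab, B.circ_assoc]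
    abel
  have hpk : (p : ZMod (p ^ n)) ^ n = 0 := by
    rw [← Nat.cast_pow, ZMod.natCast_self]
  exact ⟨{
    h := h
    g := fun a => h (B.inv a)
    h_zero := by rw [← B.one_eq, h1]
    h_add := fun a b => by rw [← hm, hab]; simp
    hg := fun a => (B.lam_pow h h1 hm a).2.1
    gh := fun a => (B.lam_pow h h1 hm a).2.2
    nil := fun a => by
      have h2 := (B.lam_pow h h1 hm a).1
      rw [hcard] at h2
      exact pow_eq_zero_of_le hn.le (bz_nilp hp hcard _ (bz_nilp2 hp hpk _ h2))
    pnil := pow_eq_zero_of_le hn.le hpk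
    unit := fun j hj hjp => bz_unit n hp j (fun h => by have := Nat.le_of_dvd hj h; omega)
    p2 := hp.two_le }, hab⟩

end brace

theorem bz_gamma (p : ℕ) (hp : p.Prime) (γ : ℕ)
    (hγ : ∀ u : (ZMod (p ^ p))ˣ, ∃ k : ℕ, (γ : ZMod (p ^ p)) ^ k = (u : ZMod (p ^ p))) :
    (∀ n, n ≤ p → ((γ ^ (p ^ (p - 1)) : ℕ) : ZMod (p ^ n)) ^ (p - 1) = 1) ∧
    ∀ n s : ℕ, 1 ≤ s → s < p - 1 →
      IsUnit (((γ ^ (p ^ (p - 1)) : ℕ) : ZMod (p ^ n)) ^ s - 1) := by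
  have p2 := hp.two_le
  have hpp : 2 < p ^ p := by
    calc 2 < 2 ^ 2 := by norm_num
      _ ≤ p ^ 2 := Nat.pow_le_pow_left p2 2
      _ ≤ p ^ p := Nat.pow_le_pow_right hp.pos p2
  have hcop : Nat.Coprime γ (p ^ p) := by
    have : Fact (2 < p ^ p) := ⟨hpp⟩
    obtain ⟨j, hj⟩ := hγ (-1)
    have hj0 : j ≠ 0 := by
      rintro rfl
      rw [pow_zero, Units.val_neg, Units.val_one] at hj
      exact ZMod.neg_one_ne_one hj.symm
    rw [← ZMod.isUnit_iff_coprime, ← isUnit_pow_iff hj0, hj]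
    exact Units.isUnit _
  constructor
  · intro n hn
    have h1 := Nat.ModEq.pow_totient hcop
    rw [Nat.totient_prime_pow hp hp.pos, pow_mul] at h1
    have h2 := h1.of_dvd (pow_dvd_pow p hn)
    rw [← ZMod.natCast_eq_natCast_iff] at h2
    simpa using h2
  · intro n s hs hsp
    have : Fact p.Prime := ⟨hp⟩
    have hγpos : 0 < γ := by
      rcases Nat.eq_zero_or_pos γ with h | h
      · subst h
        simp at hcop
        omega
      · exact h
    have hpos : 1 ≤ (γ ^ (p ^ (p - 1))) ^ s := Nat.one_le_pow _ _ (pow_pos hγpos _)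
    have h1 : ((γ ^ (p ^ (p - 1)) : ℕ) : ZMod (p ^ n)) ^ s - 1
        = (((γ ^ (p ^ (p - 1))) ^ s - 1 : ℕ) : ZMod (p ^ n)) := by
      rw [Nat.cast_sub hpos]; simp
    rw [h1]
    apply bz_unit n hp
    intro hdvd
    have h2 : (((γ ^ (p ^ (p - 1))) ^ s - 1 : ℕ) : ZMod p) = 0 :=
      (ZMod.natCast_eq_zero_iff _ _).2 hdvd
    rw [Nat.cast_sub hpos, sub_eq_zero] at h2
    push_cast at h2
    rw [ZMod.pow_card_pow] at h2
    have hs2 : ∀ u : (ZMod p)ˣ, ∃ i : Fin s, (γ : ZMod p) ^ (i : ℕ) = u := by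
      intro u
      have hc : Nat.Coprime (u : ZMod p).val (p ^ p) :=
        Nat.Coprime.pow_right _ (ZMod.val_coe_unit_coprime u)
      obtain ⟨j, hj⟩ := hγ (ZMod.unitOfCoprime _ hc)
      rw [ZMod.coe_unitOfCoprime, ← Nat.cast_pow, ZMod.natCast_eq_natCast_iff] at hj
      have hj2 := hj.of_dvd (dvd_pow_self p hp.ne_zero)
      rw [← ZMod.natCast_eq_natCast_iff] at hj2
      refine ⟨⟨j % s, Nat.mod_lt _ (by omega)⟩, ?_⟩
      rw [ZMod.natCast_zmod_val, Nat.cast_pow] at hj2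
      rw [← hj2, ← pow_eq_pow_mod j h2]
    choose f hf using hs2
    have hinj : Function.Injective f := by
      intro u v huv
      apply Units.ext
      rw [← hf u, ← hf v, huv]
    have := Fintype.card_le_of_injective f hinj
    rw [ZMod.card_units, Fintype.card_fin] at this
    omega


section words
variable {Q : Type*} [AddCommGroup Q]

def BzBi (op : Q → Q → Q) : Prop :=
  (∀ x y z, op (x + y) z = op x z + op y z) ∧ ∀ x y z, op x (y + z) = op x y + op x z

/-- `f` is given by a universal integer combination of words satisfying `P`. -/
def BzRp (P : FreeMagma (Fin 2) → Prop) (f : (Q → Q → Q) → Q → Q → Q) : Prop :=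
  ∃ e : FreeMagma (Fin 2) →₀ ℤ, (∀ w ∈ e.support, P w) ∧ ∀ op, BzBi op → ∀ x y,
    f op x y = e.sum fun w z => z • wEval op ![x, y] w

variable {P P' P'' : FreeMagma (Fin 2) → Prop} {f f' : (Q → Q → Q) → Q → Q → Q}

theorem BzRp.mono (h : BzRp P f) (hP : ∀ w, P w → P' w) : BzRp P' f := by
  obtain ⟨e, he, hf⟩ := h
  exact ⟨e, fun w hw => hP w (he w hw), hf⟩

theorem BzRp.single (w : FreeMagma (Fin 2)) (hw : P w) :
    BzRp P (fun (op : Q → Q → Q) x y => wEval op ![x, y] w) := by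
  refine ⟨Finsupp.single w 1, ?_, ?_⟩
  · intro w' hw'
    have := Finsupp.support_single_subset hw'
    rw [Finset.mem_singleton.1 this]; exact hw
  · intro op _ x y
    simp

theorem BzRp.zero : BzRp P (fun (_ : Q → Q → Q) _ _ => 0) :=
  ⟨0, by simp, by simp⟩

theorem BzRp.add (h : BzRp P f) (h' : BzRp P f') :
    BzRp P (fun op x y => f op x y + f' op x y) := by
  obtain ⟨e, he, hf⟩ := h
  obtain ⟨e', he', hf'⟩ := h'
  refine ⟨e + e', ?_, ?_⟩
  · intro w hw
    rcases Finset.mem_union.1 (Finsupp.support_add hw) with h | h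
    · exact he w h
    · exact he' w h
  · intro op hop x y
    show f op x y + f' op x y = _
    rw [hf op hop, hf' op hop, Finsupp.sum_add_index']
    · simp
    · intro w a b; rw [add_smul]

theorem BzRp.smul (h : BzRp P f) (a : ℤ) : BzRp P (fun op x y => a • f op x y) := by
  obtain ⟨e, he, hf⟩ := h
  refine ⟨a • e, fun w hw => he w (Finsupp.support_smul hw), ?_⟩
  intro op hop x y
  show a • f op x y = _
  rw [hf op hop, Finsupp.sum_smul_index (by simp), Finsupp.smul_sum]
  simp [mul_smul]

theorem BzRp.sum {ι : Type*} (s : Finset ι) (F : ι → (Q → Q → Q) → Q → Q → Q)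
    (h : ∀ i ∈ s, BzRp P (F i)) : BzRp P (fun op x y => ∑ i ∈ s, F i op x y) := by
  classical
  induction s using Finset.induction_on with
  | empty => simpa using BzRp.zero
  | insert a s ha ih =>
    simp only [Finset.sum_insert ha]
    exact (h a (Finset.mem_insert_self a s)).add
      (ih fun i hi => h i (Finset.mem_insert_of_mem hi))

theorem BzRp.op (h : BzRp P f) (h' : BzRp P' f')
    (hP : ∀ w w', P w → P' w' → P'' (w * w')) :
    BzRp P'' (fun op x y => op (f op x y) (f' op x y)) := by
  obtain ⟨e, he, hf⟩ := h
  obtain ⟨e', he', hf'⟩ := h'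
  have h1 : BzRp P'' (fun (op : Q → Q → Q) x y => ∑ w ∈ e.support, ∑ w' ∈ e'.support,
      (e w * e' w') • wEval op ![x, y] (w * w')) :=
    BzRp.sum _ _ fun w hw => BzRp.sum _ _ fun w' hw' =>
      (BzRp.single (w * w') (hP _ _ (he w hw) (he' w' hw'))).smul _
  obtain ⟨e'', he'', hf''⟩ := h1
  refine ⟨e'', he'', fun op hop x y => ?_⟩
  rw [← hf'' op hop]
  show op (f op x y) (f' op x y) = _
  rw [hf op hop, hf' op hop]
  let l : Q → Q →+ Q := fun x => AddMonoidHom.mk' (fun y => op x y) (hop.2 x)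
  let r : Q → Q →+ Q := fun y => AddMonoidHom.mk' (fun x => op x y) (fun a b => hop.1 a b y)
  have hl : ∀ x y, op x y = l x y := fun x y => rfl
  have hr : ∀ x y, op x y = r y x := fun x y => rfl
  simp only [Finsupp.sum]
  rw [hr, map_sum]
  refine Finset.sum_congr rfl fun w _ => ?_
  rw [map_zsmul, ← hr, hl, map_sum, Finset.smul_sum]
  refine Finset.sum_congr rfl fun w' _ => ?_
  rw [map_zsmul, ← hl, smul_smul]
  rfl

theorem BzRp.iter (h : BzRp P f) (h' : BzRp P' f') (hP : ∀ w w', P w → P' w' → P' (w * w'))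
    (j : ℕ) : BzRp P' (fun op x y => (op (f op x y))^[j] (f' op x y)) := by
  induction j with
  | zero => simpa using h'
  | succ j ih =>
    simp only [Function.iterate_succ_apply']
    exact h.op ih hP

def bzPX (w : FreeMagma (Fin 2)) : Prop := wCount (1 : Fin 2) w = 0 ∧ 1 ≤ wCount (0 : Fin 2) w
def bzPY (w : FreeMagma (Fin 2)) : Prop := wCount (1 : Fin 2) w = 1 ∧ wLast w = (1 : Fin 2)
def bzPV (w : FreeMagma (Fin 2)) : Prop := wCount (1 : Fin 2) w = 1 ∧ wLast w = (1 : Fin 2) ∧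
        1 ≤ wCount (0 : Fin 2) w

theorem bzPX_mul (w w' : FreeMagma (Fin 2)) (h : bzPX w) (h' : bzPX w') : bzPX (w * w') := by
  change wCount 1 w + wCount 1 w' = 0 ∧ 1 ≤ wCount 0 w + wCount 0 w'
  have := h.1
  have := h.2
  have := h'.1
  omega

theorem bzPV_mul (w w' : FreeMagma (Fin 2)) (h : bzPX w) (h' : bzPY w') : bzPV (w * w') := by
  change wCount 1 w + wCount 1 w' = 1 ∧ wLast w' = 1 ∧ 1 ≤ wCount 0 w + wCount 0 w'
  have := h.1
  have := h.2
  have := h'.1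
  exact ⟨by omega, h'.2, by omega⟩

theorem bzPY_mul (w w' : FreeMagma (Fin 2)) (h : bzPX w) (h' : bzPY w') : bzPY (w * w') :=
  ⟨(bzPV_mul w w' h h').1, (bzPV_mul w w' h h').2.1⟩

/-- The polynomial map `x ↦ Σ v_j (x·)^j x`. -/
def bzW (v : ℕ → ℤ) (M : ℕ) (op : Q → Q → Q) (x : Q) : Q :=
  ∑ j ∈ Finset.range M, v j • (op x)^[j] x

theorem bzW_rp (v : ℕ → ℤ) (M t : ℕ) :
    BzRp bzPX (fun (op : Q → Q → Q) x _ => (bzW v M op)^[t] x) := by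
  induction t with
  | zero => exact BzRp.single (FreeMagma.of 0) (by constructor <;> simp [wCount])
  | succ t ih =>
    simp only [Function.iterate_succ_apply']
    exact BzRp.sum _ _ fun j _ => (ih.iter ih bzPX_mul j).smul _

theorem bz_final_rp (v e : ℕ → ℤ) (M M' t : ℕ) :
    BzRp bzPV (fun (op : Q → Q → Q) x y => ∑ j ∈ Finset.range M',
      e j • (op ((bzW v M op)^[t] x))^[j + 1] y) := by
  have hY : BzRp bzPY (fun (_ : Q → Q → Q) _ y => y) :=
    BzRp.single (FreeMagma.of 1) (by constructor <;> simp [wCount, wLast])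
  refine BzRp.sum _ _ fun j _ =>
    BzRp.smul (f := fun op x y => (op ((bzW v M op)^[t] x))^[j + 1] y) ?_ (e j)
  simp only [Function.iterate_succ_apply']
  exact (bzW_rp v M t).op ((bzW_rp v M t).iter hY bzPY_mul j) bzPV_mul

end words

theorem bz_main (p n : ℕ) (hp : p.Prime) (hn : n < p - 1)
    (A : Type u) [AddCommGroup A] [Module (ZMod (p ^ n)) A] (hcard : Nat.card A = p ^ n)
    (γ : ℕ)
    (hγ : ∀ u : (ZMod (p ^ p))ˣ, ∃ k : ℕ, (γ : ZMod (p ^ p)) ^ k = (u : ZMod (p ^ p))) :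
    ∃ (S : Finset (FreeMagma (Fin 2))) (e : FreeMagma (Fin 2) → ℤ),
      (∀ w ∈ S, wCount (1 : Fin 2) w = 1 ∧ wLast w = (1 : Fin 2) ∧
        1 ≤ wCount (0 : Fin 2) w) ∧
      ∀ (B : LeftBrace A)
        (odot bullet :
          (A ⧸ annSub A (p ^ 2)) → (A ⧸ annSub A (p ^ 2)) → (A ⧸ annSub A (p ^ 2))),
        (∀ a b c : A, p • c = B.star (p • a) b →
          odot (qmk (p ^ 2) a) (qmk (p ^ 2) b) = qmk (p ^ 2) c) →
        (∀ x y : A, bullet (qmk (p ^ 2) x) (qmk (p ^ 2) y) =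
          ∑ i ∈ Finset.range (p - 1), (γ ^ (p ^ (p - 1))) ^ (p - 1 - i) •
            odot (qmk (p ^ 2) ((γ ^ (p ^ (p - 1))) ^ i • x)) (qmk (p ^ 2) y)) →
        ∀ a c : A,
          qmk (p ^ 2) (B.star a c) =
            ∑ w ∈ S, e w • wEval bullet ![qmk (p ^ 2) a, qmk (p ^ 2) c] w := by
  have p2 := hp.two_le
  have hfin : Finite A := Nat.finite_of_card_ne_zero (by rw [hcard]; exact pow_ne_zero _ hp.ne_zero)
  obtain ⟨hm', hξ'⟩ := bz_gamma p hp γ hγ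
  have hm := hm' n (by omega)
  have hξ := hξ' n
  set m : ℕ := γ ^ (p ^ (p - 1)) with hmdef
  clear_value m
  obtain ⟨v, e, he0, hve⟩ := BzCtx.exists_ve (p := p) (k := ZMod (p ^ n)) A
    (fun j hj hjp => bz_unit n hp j (fun h => by have := Nat.le_of_dvd hj h; omega)) hp m hm hξ
  let Q := A ⧸ annSub A (p ^ 2)
  let v' : ℕ → ℤ := fun j => (v.coeff j).cast
  let e' : ℕ → ℤ := fun j => (e.coeff (j + 1)).cast
  let t : ℕ := Nat.card (Equiv.Perm Q) - 1
  obtain ⟨E, hES, hE⟩ := bz_final_rp (Q := Q) v' e' (v.natDegree + 1) e.natDegree t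
  refine ⟨E.support, E, hES, ?_⟩
  intro B odot bullet hodot hbullet a x
  obtain ⟨c, hc⟩ := B.exists_ctx hp hn hcard
  let π : A →+ Q := QuotientAddGroup.mk' (annSub A (p ^ 2))
  have hπ : ∀ a, qmk (p ^ 2) a = π a := fun a => rfl
  have hπs : Function.Surjective π := QuotientAddGroup.mk'_surjective _
  simp only [hπ] at hodot hbullet ⊢
  have hstar : ∀ a b, B.star a b = c.L a b := by
    intro a b
    simp [LeftBrace.star, BzCtx.L, hc]
  have hsm : ∀ (r : ℕ) (a : A), r • a = (r : ZMod (p ^ n)) • a :=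
    fun r a => (Nat.cast_smul_eq_nsmul _ r a).symm
  -- the characterization of `bullet`
  have hb : ∀ x y z : A, (p : ZMod (p ^ n)) • z = c.kap m x y → bullet (π x) (π y) = π z := by
    intro x y z hz
    have h1 : ∀ i : ℕ, ∃ d : A, p • d = B.star (p • m ^ i • x) y := by
      intro i
      obtain ⟨u, hu⟩ := c.h_div hp 1 (m ^ i • x)
      refine ⟨u y, ?_⟩
      rw [hstar, BzCtx.L, hsm p (m ^ i • x)]
      rw [pow_one] at hu
      rw [hu, hsm]; simp
    choose d hd using h1
    rw [hbullet]
    have h2 : ∀ i, odot (π (m ^ i • x)) (π y) = π (d i) := fun i => hodot _ _ _ (hd i)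
    simp only [h2, ← map_nsmul, ← map_sum]
    have h3 : p • (∑ i ∈ Finset.range (p - 1), m ^ (p - 1 - i) • d i) = p • z := by
      rw [hsm p z, hz, BzCtx.kap, Finset.smul_sum, LinearMap.sum_apply]
      refine Finset.sum_congr rfl fun i _ => ?_
      rw [smul_comm, hd, hstar, BzCtx.L, hsm p, hsm (m ^ i), hsm, Nat.cast_pow, Nat.cast_pow]
      rfl
    refine (QuotientAddGroup.eq (s := annSub A (p ^ 2))).2 ?_
    change p ^ 2 • _ = 0
    rw [pow_two, mul_smul, smul_add, smul_neg, h3]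
    simp
  have hz : ∀ x y : A, ∃ z : A, (p : ZMod (p ^ n)) • z = c.kap m x y := by
    intro x y
    have h1 : ∀ i : ℕ, ∃ d : A, (p : ZMod (p ^ n)) • d
        = (c.h ((p : ZMod (p ^ n)) • (m : ZMod (p ^ n)) ^ i • x) - 1) y := by
      intro i
      obtain ⟨u, hu⟩ := c.h_div hp 1 ((m : ZMod (p ^ n)) ^ i • x)
      rw [pow_one] at hu
      exact ⟨u y, by rw [hu]; simp⟩
    choose d hd using h1
    refine ⟨∑ i ∈ Finset.range (p - 1), (m : ZMod (p ^ n)) ^ (p - 1 - i) • d i, ?_⟩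
    rw [BzCtx.kap, Finset.smul_sum, LinearMap.sum_apply]
    refine Finset.sum_congr rfl fun i _ => ?_
    rw [smul_comm, hd]; rfl
  have hbi : BzBi bullet := by
    constructor
    · intro x y z
      obtain ⟨x, rfl⟩ := hπs x
      obtain ⟨y, rfl⟩ := hπs y
      obtain ⟨z, rfl⟩ := hπs z
      obtain ⟨s, hs⟩ := hz x z
      obtain ⟨s', hs'⟩ := hz y z
      rw [hb x z s hs, hb y z s' hs', ← map_add, ← map_add]
      apply hb
      rw [c.kap_add hp m hm hξ, smul_add, hs, hs']; rfl
    · intro x y z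
      obtain ⟨x, rfl⟩ := hπs x
      obtain ⟨y, rfl⟩ := hπs y
      obtain ⟨z, rfl⟩ := hπs z
      obtain ⟨s, hs⟩ := hz x y
      obtain ⟨s', hs'⟩ := hz x z
      rw [hb x y s hs, hb x z s' hs', ← map_add, ← map_add]
      apply hb
      rw [map_add, smul_add, hs, hs']
  have hzc : ∀ (r : ZMod (p ^ n)) (y : A), π (r • y) = (r.cast : ℤ) • π y := by
    intro r y
    rw [← map_zsmul, ← Int.cast_smul_eq_zsmul (ZMod (p ^ n)), ZMod.intCast_zmod_cast]
  have hiter : ∀ (w : A) (D : Module.End (ZMod (p ^ n)) A),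
      c.kap m w = (p : ZMod (p ^ n)) • D → ∀ (j : ℕ) (y : A),
      π ((D ^ j) y) = (bullet (π w))^[j] (π y) := by
    intro w D hD j y
    induction j with
    | zero => simp
    | succ j ih =>
      rw [Function.iterate_succ_apply', ← ih, hb w ((D ^ j) y) ((D ^ (j + 1)) y)]
      rw [hD, pow_succ']; rfl
  have hW : ∀ b w : A, ∀ D : Module.End (ZMod (p ^ n)) A,
      c.kap m w = (p : ZMod (p ^ n)) • D → Polynomial.aeval D v w = b →
      bzW v' (v.natDegree + 1) bullet (π w) = π b := by
    intro b w D hD hb'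
    rw [← hb', Polynomial.aeval_eq_sum_range, LinearMap.sum_apply, map_sum, bzW]
    refine Finset.sum_congr rfl fun j _ => ?_
    rw [LinearMap.smul_apply, hzc, hiter w D hD]
  have hWs : Function.Surjective (bzW v' (v.natDegree + 1) bullet) := by
    intro y
    obtain ⟨b, rfl⟩ := hπs y
    obtain ⟨w, D, hD, hv, -⟩ := hve c b
    exact ⟨π w, hW b w D hD hv⟩
  have hfQ : Finite Q := Finite.of_surjective π hπs
  let σ : Equiv.Perm Q := Equiv.ofBijective _ (Finite.surjective_iff_bijective.1 hWs)
  have hσ : ∀ y, (bzW v' (v.natDegree + 1) bullet)^[t] (bzW v' (v.natDegree + 1) bullet y) = y := by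
    intro y
    rw [← Function.iterate_succ_apply]
    have h1 : t + 1 = Nat.card (Equiv.Perm Q) := Nat.sub_add_cancel Nat.card_pos
    have h2 : σ ^ Nat.card (Equiv.Perm Q) = 1 := pow_card_eq_one'
    have h3 : (⇑σ)^[t + 1] y = y := by
      rw [← Equiv.Perm.coe_pow, h1, h2]; rfl
    exact h3
  obtain ⟨w, D, hD, hv, hL⟩ := hve c a
  have h4 := hE bullet hbi (π a) (π x)
  rw [hstar, ← hL]
  refine Eq.trans ?_ h4
  rw [← hW a w D hD hv]
  beta_reduce
  rw [hσ, Polynomial.aeval_eq_sum_range, Finset.sum_range_succ', he0, zero_smul,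
    add_zero, LinearMap.sum_apply, map_sum]
  refine Finset.sum_congr rfl fun j _ => ?_
  rw [LinearMap.smul_apply, hzc, hiter w D hD]

/-- there are integers `e_w` (only finitely many nonzero, depending only on
the additive group `(A,+)`), indexed by words in `X,Y` with `Y` exactly once at the end
and `X` at least once, such that for every brace with additive group `(A,+)`:
`[a]*[c] = Σ_w e_w·w([a],[c])` where `w` is evaluated under the pre-Lie
multiplication `•`. Here `X` is the variable `0` and `Y` is the variable `1` of `Fin 2`. -/
theorem stmt_10 (p n : ℕ) (hp : p.Prime) (hn : n < p - 1)
    (A : Type u) [AddCommGroup A] (hcard : Nat.card A = p ^ n)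
    (γ : ℕ)
    (hγ : ∀ u : (ZMod (p ^ p))ˣ, ∃ k : ℕ, (γ : ZMod (p ^ p)) ^ k = (u : ZMod (p ^ p))) :
    ∃ (S : Finset (FreeMagma (Fin 2))) (e : FreeMagma (Fin 2) → ℤ),
      (∀ w ∈ S, wCount (1 : Fin 2) w = 1 ∧ wLast w = (1 : Fin 2) ∧
        1 ≤ wCount (0 : Fin 2) w) ∧
      ∀ (B : LeftBrace A)
        (odot bullet :
          (A ⧸ annSub A (p ^ 2)) → (A ⧸ annSub A (p ^ 2)) → (A ⧸ annSub A (p ^ 2))),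
        (∀ a b c : A, p • c = B.star (p • a) b →
          odot (qmk (p ^ 2) a) (qmk (p ^ 2) b) = qmk (p ^ 2) c) →
        (∀ x y : A, bullet (qmk (p ^ 2) x) (qmk (p ^ 2) y) =
          ∑ i ∈ Finset.range (p - 1), (γ ^ (p ^ (p - 1))) ^ (p - 1 - i) •
            odot (qmk (p ^ 2) ((γ ^ (p ^ (p - 1))) ^ i • x)) (qmk (p ^ 2) y)) →
        ∀ a c : A,
          qmk (p ^ 2) (B.star a c) =
            ∑ w ∈ S, e w • wEval bullet ![qmk (p ^ 2) a, qmk (p ^ 2) c] w := by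
  let _ : Module (ZMod (p ^ n)) A := AddCommGroup.zmodModule (n := p ^ n) (by
    intro x; rw [← hcard]; exact card_nsmul_eq_zero')
  exact bz_main p n hp hn A hcard γ hγ
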